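/- (Euler's cevian identity, hyperbolic case) Let ABC be a triangle in the hyperbolic plane and let a, b, c be points on sides BC, CA, AB such that the geodesics Aa, Bb, Cc meet in a common point O inside the triangle. Then (tanh AO / tanh Oa)·(tanh BO / tanh Ob)·(tanh CO / tanh Oc) = tanh AO / tanh Oa + tanh BO / tanh Ob + tanh CO / tanh Oc + 2. -/

import Mathlib

open UpperHalfPlane

/-- A point `x` of the hyperbolic plane (upper half-plane model, curvature −1)
lies on the geodesic segment joining `p` and `q`: since the hyperbolic plane is
uniquely geodesic, this is equivalent to the metric betweenness condition. -/
def hypBtw (p x q : UpperHalfPlane) : Prop :=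
  dist p x + dist x q = dist p q


namespace EulerAux

noncomputable def k1 (z : UpperHalfPlane) : ℝ := 1 / z.im
noncomputable def k2 (z : UpperHalfPlane) : ℝ := z.re / z.im
noncomputable def k3 (z : UpperHalfPlane) : ℝ := (z.re ^ 2 + z.im ^ 2) / z.im

lemma k1_pos (z : UpperHalfPlane) : 0 < k1 z := by
  have := z.im_pos
  unfold k1; positivity

lemma k_self (z : UpperHalfPlane) : k1 z * k3 z = k2 z ^ 2 + 1 := by
  have := z.im_pos.ne'
  unfold k1 k2 k3; field_simp

lemma k_cosh (z w : UpperHalfPlane) :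
    Real.cosh (dist z w) = (k1 z * k3 w + k3 z * k1 w) / 2 - k2 z * k2 w := by
  have h1 := z.im_pos.ne'
  have h2 := w.im_pos.ne'
  rw [UpperHalfPlane.cosh_dist, Complex.dist_eq, Complex.sq_norm, Complex.normSq_apply]
  simp only [Complex.sub_re, Complex.sub_im, UpperHalfPlane.coe_re, UpperHalfPlane.coe_im]
  unfold k1 k2 k3; field_simp; ring

lemma null_zero (w1 w2 w3 x1 x2 x3 : ℝ) (hx : 0 < x1) (hxx : x1 * x3 = x2 ^ 2 + 1)
    (hw : w1 * w3 = w2 ^ 2) (hwx : (w1 * x3 + w3 * x1) / 2 = w2 * x2) :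
    w1 = 0 ∧ w2 = 0 ∧ w3 = 0 := by
  have hx3 : 0 < x3 := by
    by_contra h
    nlinarith [mul_nonneg hx.le (neg_nonneg.mpr (not_lt.mp h)), sq_nonneg x2]
  have e : (w1 * x3 - w3 * x1) ^ 2 + 4 * w2 ^ 2 = 0 := by
    have : w1 * x3 + w3 * x1 = 2 * (w2 * x2) := by linarith
    linear_combination (w1 * x3 + w3 * x1 + 2 * (w2 * x2)) * this - 4 * x1 * x3 * hw
      - 4 * w2 ^ 2 * hxx
  have h2 : w2 = 0 := by
    have : w2 ^ 2 = 0 := by nlinarith [sq_nonneg (w1 * x3 - w3 * x1), sq_nonneg w2]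
    exact pow_eq_zero_iff (two_ne_zero) |>.mp this
  subst h2
  have h3 : w1 * x3 = 0 := by
    have : (w1 * x3 - w3 * x1) = 0 := by
      have h0 : (w1 * x3 - w3 * x1) ^ 2 = 0 := by linarith
      exact pow_eq_zero_iff (two_ne_zero) |>.mp h0
    linarith
  have h4 : w3 * x1 = 0 := by linarith
  exact ⟨(mul_eq_zero.mp h3).resolve_right hx3.ne', rfl, (mul_eq_zero.mp h4).resolve_right hx.ne'⟩

lemma btw_vec (p x q : UpperHalfPlane) (h : hypBtw p x q) :
    Real.sinh (dist p q) * k1 x = Real.sinh (dist x q) * k1 p + Real.sinh (dist p x) * k1 q ∧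
    Real.sinh (dist p q) * k2 x = Real.sinh (dist x q) * k2 p + Real.sinh (dist p x) * k2 q ∧
    Real.sinh (dist p q) * k3 x = Real.sinh (dist x q) * k3 p + Real.sinh (dist p x) * k3 q := by
  have cs := k_cosh p x
  have ct := k_cosh x q
  have cst := k_cosh p q
  unfold hypBtw at h
  rw [← h] at cst ⊢
  rw [Real.sinh_add]
  rw [Real.cosh_add] at cst
  have s2 := Real.cosh_sq (dist p x)
  have t2 := Real.cosh_sq (dist x q)
  generalize Real.cosh (dist p x) = c at *
  generalize Real.cosh (dist x q) = d at *
  generalize Real.sinh (dist p x) = s at *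
  generalize Real.sinh (dist x q) = t at *
  have hp := k_self p
  have hx := k_self x
  have hq := k_self q
  have hx1 := k1_pos x
  generalize k1 p = p1 at *
  generalize k2 p = p2 at *
  generalize k3 p = p3 at *
  generalize k1 x = x1 at *
  generalize k2 x = x2 at *
  generalize k3 x = x3 at *
  generalize k1 q = q1 at *
  generalize k2 q = q2 at *
  generalize k3 q = q3 at *
  have := null_zero ((s * d + c * t) * x1 - (t * p1 + s * q1))
    ((s * d + c * t) * x2 - (t * p2 + s * q2)) ((s * d + c * t) * x3 - (t * p3 + s * q3))
    x1 x2 x3 hx1 hx ?_ ?_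
  · obtain ⟨h1, h2, h3⟩ := this
    exact ⟨by linarith, by linarith, by linarith⟩
  · linear_combination (s * d + c * t) ^ 2 * hx + t ^ 2 * hp + s ^ 2 * hq
      + 2 * (s * d + c * t) * t * cs + 2 * (s * d + c * t) * s * ct - 2 * s * t * cst
      - t ^ 2 * s2 - s ^ 2 * t2
  · linear_combination (s * d + c * t) * hx + t * cs + s * ct

noncomputable def D (A B C : UpperHalfPlane) : ℝ :=
  k1 A * (k2 B * k3 C - k3 B * k2 C) - k2 A * (k1 B * k3 C - k3 B * k1 C)
    + k3 A * (k1 B * k2 C - k2 B * k1 C)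

lemma D_ne (A B C : UpperHalfPlane)
    (hndeg : ¬ hypBtw B A C ∧ ¬ hypBtw A B C ∧ ¬ hypBtw A C B) : D A B C ≠ 0 := by
  intro hD
  unfold hypBtw at hndeg
  rw [dist_comm B A, dist_comm C B] at hndeg
  have g : 1 + 2 * Real.cosh (dist A B) * Real.cosh (dist B C) * Real.cosh (dist A C)
      - Real.cosh (dist A B) ^ 2 - Real.cosh (dist B C) ^ 2 - Real.cosh (dist A C) ^ 2 = 0 := by
    have e : 1 + 2 * Real.cosh (dist A B) * Real.cosh (dist B C) * Real.cosh (dist A C)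
      - Real.cosh (dist A B) ^ 2 - Real.cosh (dist B C) ^ 2 - Real.cosh (dist A C) ^ 2
      = D A B C ^ 2 / 4 := by
      have hA : 1 = k1 A * k3 A - k2 A ^ 2 := by linarith [k_self A]
      have hB : 1 = k1 B * k3 B - k2 B ^ 2 := by linarith [k_self B]
      have hC : 1 = k1 C * k3 C - k2 C ^ 2 := by linarith [k_self C]
      have : ∀ x y z : ℝ, 1 + 2 * x * y * z - x ^ 2 - y ^ 2 - z ^ 2 =
        (k1 A * k3 A - k2 A ^ 2) * (k1 B * k3 B - k2 B ^ 2) * (k1 C * k3 C - k2 C ^ 2)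
         + 2 * x * y * z - x ^ 2 * (k1 C * k3 C - k2 C ^ 2) - y ^ 2 * (k1 A * k3 A - k2 A ^ 2)
         - z ^ 2 * (k1 B * k3 B - k2 B ^ 2) := by
        intro x y z
        rw [← hA, ← hB, ← hC]; ring
      rw [this, k_cosh, k_cosh, k_cosh, D]
      ring
    rw [e, hD]; norm_num
  have p0 : 0 ≤ dist A B := dist_nonneg
  have q0 : 0 ≤ dist B C := dist_nonneg
  have r0 : 0 ≤ dist A C := dist_nonneg
  generalize dist A B = p at *
  generalize dist B C = q at *
  generalize dist A C = r at *
  have f : (Real.cosh r - Real.cosh (p + q)) * (Real.cosh r - Real.cosh (p - q)) = 0 := by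
    rw [Real.cosh_add, Real.cosh_sub]
    have s2 := Real.cosh_sq p
    have t2 := Real.cosh_sq q
    linear_combination -g + (Real.sinh q) ^ 2 * s2 - (1 - Real.cosh p ^ 2) * t2
  rcases mul_eq_zero.mp f with f | f
  · have := abs_eq_abs.mp (le_antisymm (Real.cosh_le_cosh.mp (sub_eq_zero.mp f).le)
      (Real.cosh_le_cosh.mp (sub_eq_zero.mp f).ge))
    rcases this with h | h
    · exact hndeg.2.1 (by linarith)
    · exact hndeg.2.1 (by linarith)
  · have := abs_eq_abs.mp (le_antisymm (Real.cosh_le_cosh.mp (sub_eq_zero.mp f).le)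
      (Real.cosh_le_cosh.mp (sub_eq_zero.mp f).ge))
    rcases this with h | h
    · exact hndeg.2.2 (by linarith)
    · exact hndeg.1 (by linarith)

lemma cevian (A B C a O : UpperHalfPlane) (ha : hypBtw B a C) (ha1 : a ≠ B)
    (hOa : hypBtw A O a) (hOA : O ≠ A) (hOa' : O ≠ a) :
    ∃ α β γ : ℝ, k1 O = α * k1 A + β * k1 B + γ * k1 C ∧
      k2 O = α * k2 A + β * k2 B + γ * k2 C ∧
      k3 O = α * k3 A + β * k3 B + γ * k3 C ∧
      α * Real.cosh (dist A O) ≠ 0 ∧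
      Real.tanh (dist A O) / Real.tanh (dist O a) = 1 / (α * Real.cosh (dist A O)) - 1 := by
  obtain ⟨u1, u2, u3⟩ := btw_vec _ _ _ hOa
  obtain ⟨v1, v2, v3⟩ := btw_vec _ _ _ ha
  have pAO : 0 < dist A O := dist_pos.mpr hOA.symm
  have pOa : 0 < dist O a := dist_pos.mpr hOa'
  have pBC : 0 < dist B C := by
    have : 0 < dist B a := dist_pos.mpr ha1.symm
    have h2 : 0 ≤ dist a C := dist_nonneg
    unfold hypBtw at ha
    linarith
  unfold hypBtw at hOa
  have sBC := Real.sinh_pos_iff.mpr pBC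
  have sAO := Real.sinh_pos_iff.mpr pAO
  have sOa := Real.sinh_pos_iff.mpr pOa
  have cAO := Real.cosh_pos (dist A O)
  have cOa := Real.cosh_pos (dist O a)
  have sAa : 0 < Real.sinh (dist A a) := Real.sinh_pos_iff.mpr (by linarith)
  have sadd : Real.sinh (dist A a) = Real.sinh (dist A O) * Real.cosh (dist O a)
      + Real.cosh (dist A O) * Real.sinh (dist O a) := by rw [← hOa, Real.sinh_add]
  refine ⟨Real.sinh (dist O a) / Real.sinh (dist A a),
    Real.sinh (dist A O) * Real.sinh (dist a C) / (Real.sinh (dist A a) * Real.sinh (dist B C)),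
    Real.sinh (dist A O) * Real.sinh (dist B a) / (Real.sinh (dist A a) * Real.sinh (dist B C)),
    ?_, ?_, ?_, by positivity, ?_⟩
  · field_simp
    linear_combination Real.sinh (dist B C) * u1 + Real.sinh (dist A O) * v1
  · field_simp
    linear_combination Real.sinh (dist B C) * u2 + Real.sinh (dist A O) * v2
  · field_simp
    linear_combination Real.sinh (dist B C) * u3 + Real.sinh (dist A O) * v3
  · rw [Real.tanh_eq_sinh_div_cosh, Real.tanh_eq_sinh_div_cosh, sadd]
    field_simp
    ring

lemma uniq (A B C O : UpperHalfPlane) (hD : D A B C ≠ 0) (α β γ α' β' γ' : ℝ)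
    (h1 : k1 O = α * k1 A + β * k1 B + γ * k1 C)
    (h2 : k2 O = α * k2 A + β * k2 B + γ * k2 C)
    (h3 : k3 O = α * k3 A + β * k3 B + γ * k3 C)
    (h1' : k1 O = α' * k1 A + β' * k1 B + γ' * k1 C)
    (h2' : k2 O = α' * k2 A + β' * k2 B + γ' * k2 C)
    (h3' : k3 O = α' * k3 A + β' * k3 B + γ' * k3 C) : α = α' ∧ β = β' ∧ γ = γ' := by
  refine ⟨mul_right_cancel₀ hD ?_, mul_right_cancel₀ hD ?_, mul_right_cancel₀ hD ?_⟩ <;> unfold D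
  · linear_combination (h1' - h1) * (k2 B * k3 C - k3 B * k2 C)
      - (h2' - h2) * (k1 B * k3 C - k3 B * k1 C) + (h3' - h3) * (k1 B * k2 C - k2 B * k1 C)
  · linear_combination -(h1' - h1) * (k2 A * k3 C - k3 A * k2 C)
      + (h2' - h2) * (k1 A * k3 C - k3 A * k1 C) - (h3' - h3) * (k1 A * k2 C - k2 A * k1 C)
  · linear_combination (h1' - h1) * (k2 A * k3 B - k3 A * k2 B)
      - (h2' - h2) * (k1 A * k3 B - k3 A * k1 B) + (h3' - h3) * (k1 A * k2 B - k2 A * k1 B)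

end EulerAux

/-- **Euler's cevian identity (hyperbolic case).**  Let `ABC` be a nondegenerate
geodesic triangle in the hyperbolic plane, `a, b, c` interior points of the
sides `BC, CA, AB`, and suppose the geodesic segments `Aa, Bb, Cc` all pass
through a common interior point `O`.  Then
`(tanh AO / tanh Oa)·(tanh BO / tanh Ob)·(tanh CO / tanh Oc)
   = tanh AO / tanh Oa + tanh BO / tanh Ob + tanh CO / tanh Oc + 2`. -/
theorem euler_cevian_hyperbolic (A B C a b c O : UpperHalfPlane)
    (hndeg : ¬ hypBtw B A C ∧ ¬ hypBtw A B C ∧ ¬ hypBtw A C B)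
    (ha : hypBtw B a C) (ha1 : a ≠ B) (ha2 : a ≠ C)
    (hb : hypBtw C b A) (hb1 : b ≠ C) (hb2 : b ≠ A)
    (hc : hypBtw A c B) (hc1 : c ≠ A) (hc2 : c ≠ B)
    (hOa : hypBtw A O a) (hOA : O ≠ A) (hOa' : O ≠ a)
    (hOb : hypBtw B O b) (hOB : O ≠ B) (hOb' : O ≠ b)
    (hOc : hypBtw C O c) (hOC : O ≠ C) (hOc' : O ≠ c) :
    (Real.tanh (dist A O) / Real.tanh (dist O a)) *
        (Real.tanh (dist B O) / Real.tanh (dist O b)) *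
          (Real.tanh (dist C O) / Real.tanh (dist O c)) =
      Real.tanh (dist A O) / Real.tanh (dist O a) +
        Real.tanh (dist B O) / Real.tanh (dist O b) +
          Real.tanh (dist C O) / Real.tanh (dist O c) + 2 := by
  obtain ⟨α, β, γ, x1, x2, x3, n1, e1⟩ := EulerAux.cevian A B C a O ha ha1 hOa hOA hOa'
  obtain ⟨β', γ', α', y1, y2, y3, n2, e2⟩ := EulerAux.cevian B C A b O hb hb1 hOb hOB hOb'
  obtain ⟨γ'', α'', β'', z1, z2, z3, n3, e3⟩ := EulerAux.cevian C A B c O hc hc1 hOc hOC hOc'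
  have hD := EulerAux.D_ne A B C hndeg
  obtain ⟨-, rfl, -⟩ := EulerAux.uniq A B C O hD α β γ α' β' γ' x1 x2 x3
    (by linarith) (by linarith) (by linarith)
  obtain ⟨-, -, rfl⟩ := EulerAux.uniq A B C O hD α β γ α'' β'' γ'' x1 x2 x3
    (by linarith) (by linarith) (by linarith)
  have hsum : α * Real.cosh (dist A O) + β * Real.cosh (dist B O)
      + γ * Real.cosh (dist C O) = 1 := by
    rw [EulerAux.k_cosh, EulerAux.k_cosh, EulerAux.k_cosh]
    linear_combination EulerAux.k_self O - EulerAux.k3 O / 2 * x1 + EulerAux.k2 O * x2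
      - EulerAux.k1 O / 2 * x3
  rw [e1, e2, e3]
  generalize α * Real.cosh (dist A O) = u at *
  generalize β * Real.cosh (dist B O) = v at *
  generalize γ * Real.cosh (dist C O) = w at *
  field_simp
  linear_combination -hsum
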